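/- Let R be a principal ideal domain with field of fractions F, and let (G,L) be a finite non-degenerate R-network. Then the free part of Υ(G,L) has rank |∂V|; that is, Υ(G,L) ≅ R^{|∂V|} ⊕ T where T is a torsion R-module. -/

import Mathlib

open Finsupp

/-- A graph with boundary (`∂`-graph) together with a generalized Laplacian datum over `R`:
oriented edges with a fixed-point-free reversal involution, local finiteness,
a set of boundary vertices, symmetric edge weights `w` and diagonal perturbation `d`. -/
structure DNetwork (R : Type) [CommRing R] where
  V : Type
  E : Type
  src : E → V
  rev : E → E
  rev_rev : ∀ e, rev (rev e) = e
  rev_ne : ∀ e, rev e ≠ e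
  finE : ∀ x : V, Fintype {e : E // src e = x}
  boundary : Set V
  w : E → R
  w_rev : ∀ e, w (rev e) = w e
  d : V → R

namespace DNetwork

variable {R : Type} [CommRing R] (N : DNetwork R)

/-- The endpoint of an oriented edge. -/
def tgt (e : N.E) : N.V := N.src (N.rev e)

/-- The generalized Laplacian evaluated at the vertex `x`, as a linear functional on
`M`-valued functions: `Lu(x) = d(x) u(x) + ∑_{e : e₊ = x} w(e) (u(x) - u(e₋))`. -/
noncomputable def lapAt {M : Type} [AddCommGroup M] [Module R M] (x : N.V) :
    (N.V → M) →ₗ[R] M :=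
  letI := N.finE x
  N.d x • (LinearMap.proj x : (N.V → M) →ₗ[R] M) +
    ∑ e : {e : N.E // N.src e = x},
      N.w e.1 • ((LinearMap.proj x : (N.V → M) →ₗ[R] M) - LinearMap.proj (N.tgt e.1))

/-- The generalized Laplacian applied to the basis chain at the vertex `x`. -/
noncomputable def lapSingle (x : N.V) : N.V →₀ R :=
  letI := N.finE x
  N.d x • Finsupp.single x 1 +
    ∑ e : {e : N.E // N.src e = x},
      N.w e.1 • (Finsupp.single x 1 - Finsupp.single (N.tgt e.1) 1)

/-- The generalized Laplacian as a linear endomorphism of the module `RV` of `0`-chains. -/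
noncomputable def chainLap : (N.V →₀ R) →ₗ[R] (N.V →₀ R) :=
  Finsupp.lsum R fun x => LinearMap.toSpanSingleton R _ (N.lapSingle x)

/-- The set of interior vertices. -/
def interior : Set N.V := N.boundaryᶜ

/-- The submodule `L(RV°)` of `RV`. -/
noncomputable def lapImage : Submodule R (N.V →₀ R) :=
  Submodule.map N.chainLap (Finsupp.supported R R N.interior)

/-- The fundamental module `Υ(G,L) = RV / L(RV°)`. -/
abbrev Upsilon := (N.V →₀ R) ⧸ N.lapImage

/-- The submodule of `M`-valued harmonic functions `U(G,L,M)`. -/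
noncomputable def harmonic (M : Type) [AddCommGroup M] [Module R M] :
    Submodule R (N.V → M) :=
  ⨅ x ∈ N.interior, LinearMap.ker (N.lapAt (M := M) x)

/-- The module `U₀(G,L,M)` of finitely supported `M`-valued functions `u` with
`u = 0` on the boundary and `Lu ≡ 0` everywhere. -/
noncomputable def U0 (M : Type) [AddCommGroup M] [Module R M] :
    Submodule R (N.V →₀ M) :=
  (⨅ x ∈ N.boundary, LinearMap.ker (Finsupp.lapply (M := M) (R := R) x)) ⊓
    (⨅ x : N.V, LinearMap.ker ((N.lapAt (M := M) x).comp Finsupp.lcoeFun))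

/-- Adjacency via an oriented edge. -/
def Adj (x y : N.V) : Prop := ∃ e : N.E, N.src e = x ∧ N.tgt e = y

/-- Connectivity of the underlying graph. -/
def Connected : Prop := ∀ x y : N.V, Relation.ReflTransGen N.Adj x y

end DNetwork

namespace DNetwork

variable {R : Type} [CommRing R] (N : DNetwork R)

/-- On a finite network the Laplacian on chains agrees with the Laplacian on functions;
this uses the symmetry of the edge weights. -/
theorem chainLap_apply [Fintype N.V] (u : N.V →₀ R) (y : N.V) :
    N.chainLap u y = N.lapAt y u := by
  classical
  let := N.finE
  let : Fintype N.E := Fintype.ofEquiv _ (Equiv.sigmaFiberEquiv N.src)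
  have chain_eq : N.chainLap u y = N.d y * u y +
      (∑ e : N.E, u (N.src e) * N.w e * (if N.src e = y then 1 else 0) -
        ∑ e : N.E, u (N.src e) * N.w e * (if N.tgt e = y then 1 else 0)) := by
    have h : N.chainLap u y = ∑ x, u x * N.lapSingle x y := by
      simp [chainLap, Finsupp.sum_fintype]
    have hs : ∀ x, u x * N.lapSingle x y = u x * (N.d x * (if x = y then 1 else 0)) +
        ∑ e : {e : N.E // N.src e = x}, (u (N.src e.1) * N.w e.1 *
          ((if N.src e.1 = y then 1 else 0) - (if N.tgt e.1 = y then 1 else 0))) := by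
      intro x
      simp only [lapSingle, Finsupp.add_apply, Finsupp.smul_apply, Finsupp.finsetSum_apply,
        Finsupp.sub_apply, Finsupp.single_apply, smul_eq_mul, mul_add, Finset.mul_sum]
      congr 1
      refine Finset.sum_congr rfl fun e _ => ?_
      rw [e.2, mul_assoc]
    have fiberwise : ∀ f : N.E → R,
        ∑ x, ∑ e : {e : N.E // N.src e = x}, f e.1 = ∑ e, f e := by
      intro f
      convert Fintype.sum_fiberwise N.src f
    rw [h, Finset.sum_congr rfl fun x _ => hs x, Finset.sum_add_distrib,
      fiberwise (fun e => u (N.src e) * N.w e *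
          ((if N.src e = y then 1 else 0) - (if N.tgt e = y then 1 else 0))),
      ← Finset.sum_sub_distrib]
    congr 1
    · simp [mul_comm]
    · exact Finset.sum_congr rfl fun e _ => mul_sub _ _ _
  have sum_rev : ∑ e : N.E, u (N.src e) * N.w e * (if N.tgt e = y then 1 else 0) =
      ∑ e : N.E, u (N.tgt e) * N.w e * (if N.src e = y then 1 else 0) := by
    refine Fintype.sum_equiv (Function.Involutive.toPerm N.rev N.rev_rev) _ _ fun e => ?_
    change _ = u (N.src (N.rev (N.rev e))) * N.w (N.rev e) * (if N.src (N.rev e) = y then 1 else 0)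
    rw [N.rev_rev, N.w_rev, tgt]
  have lap_eq : N.lapAt y u = N.d y * u y +
      ∑ e : {e : N.E // N.src e = y}, N.w e.1 * (u y - u (N.tgt e.1)) := by
    simp [lapAt]
  rw [chain_eq, sum_rev, lap_eq, ← Finset.sum_sub_distrib]
  congr 1
  simp only [← sub_mul]
  simp only [mul_ite, mul_one, mul_zero]
  rw [← Finset.sum_filter, Finset.sum_subtype (p := fun e => N.src e = y) _ (by simp)]
  refine Finset.sum_congr rfl fun e _ => ?_
  rw [e.2]
  ring

theorem disjoint_supported_ker_chainLap_of_U0_eq_bot [Fintype N.V] (h : N.U0 R = ⊥) :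
    Disjoint (Finsupp.supported R R N.interior) (LinearMap.ker N.chainLap) := by
  rw [Submodule.disjoint_def]
  intro u hu hker
  rw [← Submodule.mem_bot R, ← h, U0]
  simp only [Submodule.mem_inf, Submodule.mem_iInf, LinearMap.mem_ker]
  refine ⟨fun x hx => ?_, fun x => ?_⟩
  · exact (Finsupp.mem_supported' R u).1 hu x (not_not.2 hx)
  · change N.lapAt x u = 0
    rw [← N.chainLap_apply, LinearMap.mem_ker.1 hker, Finsupp.zero_apply]

theorem finrank_upsilon [IsDomain R] [Fintype N.V] (h : N.U0 R = ⊥) :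
    Module.finrank R N.Upsilon = Nat.card N.boundary := by
  classical
  have image : Module.finrank R N.lapImage = Nat.card N.interior := by
    have inj : Function.Injective (N.chainLap.domRestrict (Finsupp.supported R R N.interior)) := by
      rw [LinearMap.injective_domRestrict_iff]
      exact N.disjoint_supported_ker_chainLap_of_U0_eq_bot h
    rw [lapImage, ← LinearMap.range_domRestrict, LinearMap.finrank_range_of_inj inj,
      (Finsupp.supportedEquivFinsupp (R := R) (M := R) N.interior).finrank_eq,
      Module.finrank_finsupp_self, Nat.card_eq_fintype_card]
  have total := N.lapImage.finrank_quotient_add_finrank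
  rw [image, Module.finrank_finsupp_self, ← Nat.card_eq_fintype_card] at total
  have card := Set.ncard_add_ncard_compl N.boundary
  rw [← Nat.card_coe_set_eq, ← Nat.card_coe_set_eq] at card
  change _ + Nat.card ↥(N.boundaryᶜ) = _ at total
  exact Nat.add_right_cancel (total.trans card.symm)

end DNetwork

theorem Module.nonempty_equiv_free_prod_torsion (R M : Type*) [CommRing R] [IsDomain R]
    [IsPrincipalIdealRing R] [AddCommGroup M] [Module R M] [Module.Finite R M] :
    Nonempty (M ≃ₗ[R] (Fin (Module.finrank R M) → R) × Submodule.torsion R M) := by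
  have rank_torsion : Module.finrank R (Submodule.torsion R M) = 0 :=
    Module.finrank_eq_zero_iff_isTorsion.2 (Submodule.torsion_isTorsion)
  have rank_quot := (Submodule.torsion R M).finrank_quotient_add_finrank
  rw [rank_torsion, add_zero] at rank_quot
  obtain ⟨f, hf⟩ := Module.projective_lifting_property _ LinearMap.id
    (Submodule.torsion R M).mkQ_surjective
  have e := lequivProdOfRightSplitExact (Submodule.torsion R M).injective_subtype
    (by rw [Submodule.range_subtype, Submodule.ker_mkQ]) hf
  exact ⟨e.symm.trans ((LinearEquiv.prodComm R _ _).trans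
    ((LinearEquiv.ofFinrankEq _ _ (by simp [rank_quot])).prodCongr (LinearEquiv.refl R _)))⟩

/-- over a PID, for a finite non-degenerate network, the free part of
`Υ(G,L)` has rank `|∂V|`: `Υ(G,L) ≅ R^{|∂V|} ⊕ T` with `T` torsion. -/
theorem upsilon_free_rank_card_boundary
    {R : Type} [CommRing R] [IsDomain R] [IsPrincipalIdealRing R]
    (N : DNetwork R) [Fintype N.V]
    (hnd : N.U0 R = ⊥) :
    ∃ (T : Type) (_ : AddCommGroup T) (_ : Module R T),
      Module.IsTorsion R T ∧
        Nonempty (N.Upsilon ≃ₗ[R] ((Fin (Nat.card N.boundary) → R) × T)) := by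
  rw [← N.finrank_upsilon hnd]
  exact ⟨Submodule.torsion R N.Upsilon, inferInstance, inferInstance,
    Submodule.torsion_isTorsion, Module.nonempty_equiv_free_prod_torsion R N.Upsilon⟩
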